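/- For every integer n ≥ 1 and all α, β : Fin n → ℝ≥0 with β i ≤ α i for every i, there exists a deterministic online allocation algorithm F such that for every personalized 2-value stream v with parameters α, β, the induced allocation satisfies: (1) |A_i^n| = 1 for every agent i, i.e., each agent receives exactly one of the first n goods; (2) for every time step T and every agent i, the number of goods t ∈ A_i^T with v t i = α i is at least ⌊n_h(i,T)/(3n−2)⌋, and moreover if n_h(i,T) ≥ n then A_i^T contains at least one good t with v t i = α i; (3) for every time step T ≥ n and every agent i, |A_i^T| ≥ ⌊(T−n)/(2n−1)⌋ + 1. -/

import Mathlib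

open Finset
open scoped Classical

noncomputable section

/-- The agent to whom good `t` is assigned by the deterministic online algorithm `F`
on stream `v`: `σ(t) = F [v 0, …, v t]`. -/
def alloc (n : ℕ) (F : List (Fin n → NNReal) → Fin n) (v : ℕ → Fin n → NNReal) (t : ℕ) : Fin n :=
  F ((List.range (t + 1)).map v)

/-- The bundle of agent `i` at the end of time step `T`. -/
def bundle (n : ℕ) (F : List (Fin n → NNReal) → Fin n) (v : ℕ → Fin n → NNReal)
    (i : Fin n) (T : ℕ) : Finset ℕ :=
  (Finset.range T).filter fun t => alloc n F v t = i

structure St (n : ℕ) where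
  t : ℕ
  b : ℕ
  R : ℕ
  U : Finset (Fin n)
  D : Finset (Fin n)
  key : Fin n → ℕ
  cnt : Fin n → ℕ
  hc : Fin n → ℕ
  nh : Fin n → ℕ
  l1 : Fin n → ℕ
  l2 : Fin n → ℕ

/-- initial state -/
def St.init (n : ℕ) : St n :=
  ⟨0, 0, n, Finset.univ, ∅, fun _ => 0, fun _ => 0, fun _ => 0, fun _ => 0, fun _ => 0, fun _ => 0⟩

/-- admissible recipients -/
def St.Good {n : ℕ} (s : St n) (S : Finset (Fin n)) (i : Fin n) : Prop :=
  (s.b = 0 ∧ i ∈ s.U ∧ (i ∈ S ∨ ∀ j ∈ s.U, j ∉ S)) ∨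
  (s.b ≠ 0 ∧ ((i ∈ S ∧ i ∉ s.D ∧ ∀ j ∈ S, j ∉ s.D → s.key i ≤ s.key j) ∨
    ((∀ j ∈ S, j ∈ s.D) ∧ (i ∈ s.U ∨ s.U = ∅))))

/-- the core update when `i` receives the good -/
def St.core {n : ℕ} (s : St n) (S : Finset (Fin n)) (i : Fin n) : St n where
  t := s.t + 1
  b := s.b
  R := s.R - 1
  U := s.U.erase i
  D := if i ∈ S then insert i s.D else s.D
  key := fun j => if j = i then (if i ∈ S then n + s.t else if s.b = 0 then s.t else s.key j)
    else s.key j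
  cnt := fun j => if j = i then s.cnt j + 1 else s.cnt j
  hc := fun j => if j = i ∧ i ∈ S then s.hc j + 1 else s.hc j
  nh := fun j => if j ∈ S then s.nh j + 1 else s.nh j
  l1 := fun j => if j ∈ S then (if j = i then 0 else if j ∈ s.D then s.l1 j + 1 else s.l1 j)
    else s.l1 j
  l2 := fun j => if j ∈ S then (if j = i then 0 else if j ∈ s.D then s.l2 j else s.l2 j + 1)
    else s.l2 j

/-- start a new block when the current one is over -/
def St.wrap {n : ℕ} (s : St n) : St n :=
  if s.R = 0 then { s with b := s.b + 1, R := 2 * n - 1, U := Finset.univ, D := ∅ } else s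

structure St.Inv {n : ℕ} (s : St n) : Prop where
  time : s.t + s.R = n + s.b * (2 * n - 1)
  Rle : s.R ≤ 2 * n - 1
  DU : ∀ i ∈ s.D, i ∉ s.U
  ph1 : s.b = 0 → s.U.card = s.R
  post : s.b ≠ 0 → s.U.Nonempty → 2 * n - 1 + s.U.card ≤ s.R + n + s.D.card
  cntU : s.b = 0 → ∀ i ∈ s.U, s.cnt i = 0
  cnt1 : s.t ≤ n → ∀ i, s.cnt i ≤ 1
  cntb : ∀ i, s.b ≤ s.cnt i
  cntb1 : ∀ i, i ∉ s.U → s.b + 1 ≤ s.cnt i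
  keylt : ∀ i, s.key i < n + s.t
  keyU : s.b = 0 → ∀ i ∈ s.U, s.key i = 0
  keyL : s.b = 0 → ∀ i, i ∉ s.U → i ∉ s.D → s.key i < s.t
  l2U : s.b = 0 → ∀ i ∈ s.U, s.l2 i ≤ (Finset.univ.filter fun j => n ≤ s.key j).card
  l2N : ∀ i, ¬ (s.b = 0 ∧ i ∈ s.U) →
    s.l2 i ≤ (Finset.univ.filter fun j => s.key i < s.key j).card
  l1D : ∀ i ∈ s.D, s.l1 i + s.R ≤ 2 * n - 2
  l1le : ∀ i, s.l1 i ≤ 2 * n - 2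
  Dhc : ∀ i ∈ s.D, 0 < s.hc i
  hc0 : ∀ i, s.hc i = 0 → s.l1 i = 0
  nhle : ∀ i, s.nh i ≤ (3 * n - 2) * s.hc i + s.l1 i + s.l2 i

theorem St.Inv.l2le {n : ℕ} {s : St n} (h : s.Inv) (i : Fin n) : s.l2 i ≤ n - 1 := by
  have aux : ∀ (p : Fin n → Prop) [DecidablePred p], ¬ p i → (Finset.univ.filter p).card ≤ n - 1 := by
    intro p _ hp
    have : (Finset.univ.filter p) ⊆ Finset.univ.erase i := by
      intro j hj
      simp only [Finset.mem_filter, Finset.mem_univ, true_and, Finset.mem_erase, and_true] at *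
      rintro rfl; exact hp hj
    have := Finset.card_le_card this
    simpa using this
  have hn : 0 < n := i.pos
  by_cases hc : s.b = 0 ∧ i ∈ s.U
  · refine (h.l2U hc.1 i hc.2).trans (aux _ ?_)
    rw [h.keyU hc.1 i hc.2]; omega
  · exact (h.l2N i hc).trans (aux _ (by simp))

theorem St.init_inv (n : ℕ) (hn : 1 ≤ n) : (St.init n).Inv := by
  constructor <;> simp [St.init] <;> omega

theorem St.Inv.empty_of_R {n : ℕ} {s : St n} (h : s.Inv) (h0 : s.R = 0) : s.U = ∅ := by
  by_cases hb : s.b = 0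
  · have := h.ph1 hb
    rw [h0] at this
    exact Finset.card_eq_zero.mp this
  · by_contra hne
    have hU : s.U.Nonempty := Finset.nonempty_iff_ne_empty.mpr hne
    have h1 := h.post hb hU
    have h2 : (s.D ∪ s.U).card = s.D.card + s.U.card :=
      Finset.card_union_of_disjoint (Finset.disjoint_left.mpr h.DU)
    have h3 := Finset.card_le_univ (s.D ∪ s.U)
    simp only [Fintype.card_fin] at h3
    have := hU.card_pos
    omega

theorem St.Inv.wrap {n : ℕ} {s : St n} (hn : 1 ≤ n) (h : s.Inv) : s.wrap.Inv ∧ 1 ≤ s.wrap.R := by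
  unfold St.wrap
  split_ifs with h0
  · have hU := h.empty_of_R h0
    refine ⟨?_, by simp; omega⟩
    have hL := h.l2N
    have hb1 := h.cntb1
    have ht := h.time
    rw [h0] at ht
    simp only [hU, Finset.notMem_empty, and_false, not_false_eq_true, true_implies] at hL hb1
    constructor <;> simp
    · rw [Nat.add_mul]; omega
    · exact h.cnt1
    · exact hb1
    · exact h.keylt
    · exact hL
    · exact h.l1le
    · exact h.hc0
    · exact h.nhle
  · exact ⟨h, by omega⟩

theorem St.Inv.exists_good {n : ℕ} {s : St n} (hn : 1 ≤ n) (h : s.Inv) (hR : 1 ≤ s.R)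
    (S : Finset (Fin n)) : ∃ i, s.Good S i := by
  by_cases hb : s.b = 0
  · have hU : s.U.Nonempty := by
      rw [← Finset.card_pos, h.ph1 hb]; omega
    by_cases hS : ∃ i ∈ s.U, i ∈ S
    · obtain ⟨i, hi, hiS⟩ := hS
      exact ⟨i, Or.inl ⟨hb, hi, Or.inl hiS⟩⟩
    · push Not at hS
      obtain ⟨i, hi⟩ := hU
      exact ⟨i, Or.inl ⟨hb, hi, Or.inr hS⟩⟩
  · by_cases hS : (S \ s.D).Nonempty
    · obtain ⟨i, hi, hm⟩ := Finset.exists_min_image _ s.key hS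
      rw [Finset.mem_sdiff] at hi
      exact ⟨i, Or.inr ⟨hb, Or.inl ⟨hi.1, hi.2, fun j hj hjD => hm j (by simp [hj, hjD])⟩⟩⟩
    · have hS' : ∀ j ∈ S, j ∈ s.D := by
        intro j hj; by_contra hD; exact hS ⟨j, by simp [hj, hD]⟩
      rcases s.U.eq_empty_or_nonempty with hU | ⟨i, hi⟩
      · exact ⟨⟨0, hn⟩, Or.inr ⟨hb, Or.inr ⟨hS', Or.inr hU⟩⟩⟩
      · exact ⟨i, Or.inr ⟨hb, Or.inr ⟨hS', Or.inl hi⟩⟩⟩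

theorem St.Inv.core {n : ℕ} {s : St n} (hn : 1 ≤ n) (h : s.Inv) (hR : 1 ≤ s.R)
    (S : Finset (Fin n)) (i : Fin n) (hg : s.Good S i) : (s.core S i).Inv := by
  have hl2 := h.l2le
  have htb : s.t < n → s.b = 0 := by
    intro ht
    by_contra hb
    have h1 := h.time
    have h2 := h.Rle
    have : 1 * (2 * n - 1) ≤ s.b * (2 * n - 1) := Nat.mul_le_mul_right _ (by omega)
    omega
  have htb' : s.b = 0 → s.t < n := by
    intro hb
    have h1 := h.time
    rw [hb] at h1; omega
  have hU0 : s.b = 0 → i ∈ s.U := by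
    intro hb; rcases hg with hg | hg
    · exact hg.2.1
    · exact absurd hb hg.1
  -- keys do not decrease
  have hkey : ∀ j, s.key j ≤ (s.core S i).key j := by
    intro j
    simp only [St.core]
    split_ifs with h1 h2 h3
    · exact (h.keylt j).le
    · subst h1; rw [h.keyU h3 _ (hU0 h3)]; omega
    · exact le_rfl
    · exact le_rfl
  have hkeyj : ∀ j, j ≠ i → (s.core S i).key j = s.key j := by
    intro j hj; simp [St.core, hj]
  constructor
  · have := h.time; simp only [St.core]; omega
  · have := h.Rle; simp only [St.core]; omega
  · intro j hj hjU
    simp only [St.core, Finset.mem_erase] at hj hjU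
    split_ifs at hj
    · rcases Finset.mem_insert.mp hj with hj | hj
      · exact hjU.1 hj
      · exact h.DU j hj hjU.2
    · exact h.DU j hj hjU.2
  · intro hb
    have := h.ph1 hb
    simp only [St.core]
    rw [Finset.card_erase_of_mem (hU0 hb)]; omega
  · intro hb hU
    simp only [St.core] at hb hU ⊢
    have hU' : s.U.Nonempty := hU.mono (Finset.erase_subset _ _)
    have hp := h.post hb hU'
    have hUc : (s.U.erase i).card ≤ s.U.card := Finset.card_le_card (Finset.erase_subset _ _)
    rcases hg with hg | ⟨-, ⟨h1, h2, -⟩ | ⟨h1, h2⟩⟩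
    · exact absurd hg.1 hb
    · rw [if_pos h1, Finset.card_insert_of_notMem h2]; omega
    · have hiU : i ∈ s.U := by
        rcases h2 with h2 | h2
        · exact h2
        · simp [h2] at hU'
      have := Finset.card_pos.mpr hU'
      have h3 : s.D.card ≤ (if i ∈ S then insert i s.D else s.D).card := by
        apply Finset.card_le_card
        split_ifs
        · exact Finset.subset_insert _ _
        · exact subset_rfl
      rw [Finset.card_erase_of_mem hiU]
      omega
  · intro hb j hj
    simp only [St.core, Finset.mem_erase] at hb hj ⊢
    rw [if_neg hj.1]; exact h.cntU hb j hj.2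
  · intro ht j
    simp only [St.core] at ht ⊢
    split_ifs with hj
    · subst hj
      have hb := htb (by omega)
      rw [h.cntU hb _ (hU0 hb)]
    · exact h.cnt1 (by omega) j
  · intro j
    have := h.cntb j
    simp only [St.core]; split_ifs <;> omega
  · intro j hj
    simp only [St.core, Finset.mem_erase, not_and_or, not_not] at hj ⊢
    split_ifs with h1
    · have := h.cntb j; omega
    · exact h.cntb1 j (hj.resolve_left h1)
  · intro j
    have := h.keylt j
    simp only [St.core]; split_ifs <;> omega
  · intro hb j hj
    rw [hkeyj j (Finset.ne_of_mem_erase hj)]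
    exact h.keyU hb j (Finset.mem_of_mem_erase hj)
  · intro hb j hjU hjD
    by_cases hj : j = i
    · subst hj
      have hS : j ∉ S := by
        intro hS; apply hjD; simp [St.core, hS]
      have hb' : s.b = 0 := hb
      simp [St.core, hS, hb']
    · rw [hkeyj j hj]
      have : s.key j < s.t := by
        apply h.keyL hb
        · intro hU; exact hjU (Finset.mem_erase.mpr ⟨hj, hU⟩)
        · intro hD; apply hjD; simp only [St.core]
          split_ifs
          · exact Finset.mem_insert_of_mem hD
          · exact hD
      simp only [St.core]; omega
  · -- l2U
    intro hb j hj
    have hji : j ≠ i := Finset.ne_of_mem_erase hj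
    have hjU : j ∈ s.U := Finset.mem_of_mem_erase hj
    have hb' : s.b = 0 := hb
    have hold := h.l2U hb' j hjU
    have hsub : (Finset.univ.filter fun k => n ≤ s.key k) ⊆
        (Finset.univ.filter fun k => n ≤ (s.core S i).key k) := by
      intro k hk
      simp only [Finset.mem_filter, Finset.mem_univ, true_and] at hk ⊢
      exact hk.trans (hkey k)
    by_cases hjS : j ∈ S
    · have hiS : i ∈ S := by
        rcases hg with ⟨-, -, hg | hg⟩ | hg
        · exact hg
        · exact absurd hjS (hg j hjU)
        · exact absurd hb' hg.1
      have hlt : (Finset.univ.filter fun k => n ≤ s.key k).card <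
        (Finset.univ.filter fun k => n ≤ (s.core S i).key k).card := by
        apply Finset.card_lt_card
        refine (Finset.ssubset_iff_of_subset hsub).mpr ⟨i, ?_, ?_⟩
        · simp [St.core, hiS]
        · simp only [Finset.mem_filter, Finset.mem_univ, true_and]
          rw [h.keyU hb' i (hU0 hb')]; omega
      have : (s.core S i).l2 j ≤ s.l2 j + 1 := by
        simp only [St.core]; split_ifs <;> omega
      omega
    · have : (s.core S i).l2 j = s.l2 j := by simp [St.core, hjS]
      rw [this]
      exact hold.trans (Finset.card_le_card hsub)
  · -- l2N
    intro j hj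
    by_cases hji : j = i
    · subst hji
      by_cases hjS : j ∈ S
      · simp [St.core, hjS]
      · have e : (s.core S j).l2 j = s.l2 j := by simp [St.core, hjS]
        rw [e]
        by_cases hb : s.b = 0
        · refine (h.l2U hb j (hU0 hb)).trans (Finset.card_le_card ?_)
          intro k hk
          simp only [Finset.mem_filter, Finset.mem_univ, true_and] at hk ⊢
          have h1 : (s.core S j).key j = s.t := by simp [St.core, hjS, hb]
          have := hkey k
          have := htb' hb
          omega
        · refine (h.l2N j (fun hh => hb hh.1)).trans (Finset.card_le_card ?_)
          intro k hk
          simp only [Finset.mem_filter, Finset.mem_univ, true_and] at hk ⊢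
          have h1 : (s.core S j).key j = s.key j := by simp [St.core, hjS, hb]
          have := hkey k
          omega
    · have hj' : ¬ (s.b = 0 ∧ j ∈ s.U) := by
        rintro ⟨hb, hU⟩; exact hj ⟨hb, Finset.mem_erase.mpr ⟨hji, hU⟩⟩
      have hold := h.l2N j hj'
      have hsub : (Finset.univ.filter fun k => s.key j < s.key k) ⊆
          (Finset.univ.filter fun k => (s.core S i).key j < (s.core S i).key k) := by
        intro k hk
        simp only [Finset.mem_filter, Finset.mem_univ, true_and] at hk ⊢
        rw [hkeyj j hji]
        exact hk.trans_le (hkey k)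
      by_cases hjS : j ∈ S ∧ j ∉ s.D
      · have hlt : (Finset.univ.filter fun k => s.key j < s.key k).card <
          (Finset.univ.filter fun k => (s.core S i).key j < (s.core S i).key k).card := by
          apply Finset.card_lt_card
          refine (Finset.ssubset_iff_of_subset hsub).mpr ⟨i, ?_, ?_⟩
          · simp only [Finset.mem_filter, Finset.mem_univ, true_and]
            rw [hkeyj j hji]
            by_cases hiS : i ∈ S
            · have := h.keylt j
              simpa [St.core, hiS] using this
            · have hb : s.b = 0 := by
                rcases hg with hg | ⟨-, hg | hg⟩
                · exact hg.1
                · exact absurd hg.1 hiS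
                · exact absurd (hg.1 j hjS.1) hjS.2
              have := h.keyL hb j (fun hU => hj' ⟨hb, hU⟩) hjS.2
              simpa [St.core, hiS, hb] using this
          · simp only [Finset.mem_filter, Finset.mem_univ, true_and, not_lt]
            rcases hg with hg | ⟨-, hg | hg⟩
            · rw [h.keyU hg.1 i hg.2.1]; omega
            · exact hg.2.2 j hjS.1 hjS.2
            · exact absurd (hg.1 j hjS.1) hjS.2
        have : (s.core S i).l2 j ≤ s.l2 j + 1 := by
          simp only [St.core]; split_ifs <;> omega
        omega
      · have : (s.core S i).l2 j = s.l2 j := by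
          by_cases h1 : j ∈ S
          · have : j ∈ s.D := by by_contra h2; exact hjS ⟨h1, h2⟩
            simp [St.core, h1, this, hji]
          · simp [St.core, h1]
        rw [this]
        exact hold.trans (Finset.card_le_card hsub)
  · -- l1D
    intro j hj
    have hRle := h.Rle
    simp only [St.core] at hj ⊢
    by_cases hji : j = i
    · subst hji
      by_cases hS : j ∈ S
      · simp [hS]; omega
      · simp [hS] at hj ⊢
        have := h.l1D j hj; omega
    · have hD : j ∈ s.D := by
        split_ifs at hj
        · exact Finset.mem_of_mem_insert_of_ne hj hji
        · exact hj
      have := h.l1D j hD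
      split_ifs <;> omega
  · intro j
    have := h.l1le j
    simp only [St.core]
    split_ifs with h1 h2 h3
    · omega
    · have := h.l1D j h3; omega
    · exact this
    · exact this
  · intro j hj
    simp only [St.core] at hj ⊢
    split_ifs with h1
    · omega
    · apply h.Dhc
      split_ifs at hj with h2
      · exact Finset.mem_of_mem_insert_of_ne hj (fun h3 => h1 ⟨h3, h2⟩)
      · exact hj
  · intro j hj
    have h1 := h.hc0 j
    have h2 := h.Dhc j
    simp only [St.core] at hj ⊢
    split_ifs at hj with h3
    have := h1 hj
    split_ifs with h4 h5 h6
    · rfl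
    · have := h2 h6; omega
    · exact this
    · exact this
  · intro j
    have h1 := h.nhle j
    have h2 := h.l1le j
    have h3 := hl2 j
    simp only [St.core]
    by_cases hS : j ∈ S
    · by_cases hji : j = i
      · subst hji
        simp only [hS, and_self, if_true]
        rw [Nat.mul_add]; omega
      · simp only [hS, hji, false_and, if_true, if_false]
        split_ifs <;> omega
    · have : ¬ (j = i ∧ i ∈ S) := by rintro ⟨rfl, h4⟩; exact hS h4
      simp only [hS, this, if_false]; exact h1

/-- the recipient -/
def St.pick {n : ℕ} (hn : 1 ≤ n) (s : St n) (S : Finset (Fin n)) : Fin n :=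
  if h : ∃ i, s.Good S i then h.choose else ⟨0, hn⟩

/-- one full step -/
def St.next {n : ℕ} (hn : 1 ≤ n) (s : St n) (S : Finset (Fin n)) : St n :=
  (s.core S (s.pick hn S)).wrap

/-- the agents for whom the good is high-valued -/
def highSet {n : ℕ} (α x : Fin n → NNReal) : Finset (Fin n) := Finset.univ.filter fun i => x i = α i

/-- the state after a list of goods -/
def St.run {n : ℕ} (hn : 1 ≤ n) (α : Fin n → NNReal) (l : List (Fin n → NNReal)) : St n :=
  l.foldl (fun s x => s.next hn (highSet α x)) (St.init n)

/-- the algorithm -/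
def theAlg {n : ℕ} (hn : 1 ≤ n) (α : Fin n → NNReal) (l : List (Fin n → NNReal)) : Fin n :=
  (St.run hn α l.dropLast).pick hn (highSet α (l.getLast?.getD 0))

theorem St.run_succ {n : ℕ} (hn : 1 ≤ n) (α : Fin n → NNReal) (v : ℕ → Fin n → NNReal) (t : ℕ) :
    St.run hn α ((List.range (t + 1)).map v) =
      (St.run hn α ((List.range t).map v)).next hn (highSet α (v t)) := by
  simp [St.run, List.range_succ]

theorem alloc_theAlg {n : ℕ} (hn : 1 ≤ n) (α : Fin n → NNReal) (v : ℕ → Fin n → NNReal) (t : ℕ) :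
    alloc n (theAlg hn α) v t =
      (St.run hn α ((List.range t).map v)).pick hn (highSet α (v t)) := by
  simp [alloc, theAlg, List.range_succ]

theorem St.wrap_same {n : ℕ} (s : St n) :
    s.wrap.t = s.t ∧ s.wrap.cnt = s.cnt ∧ s.wrap.hc = s.hc ∧ s.wrap.nh = s.nh := by
  unfold St.wrap; split_ifs <;> simp

theorem run_spec {n : ℕ} (hn : 1 ≤ n) (α : Fin n → NNReal) (v : ℕ → Fin n → NNReal) (T : ℕ) :
    let s := St.run hn α ((List.range T).map v)
    s.Inv ∧ 1 ≤ s.R ∧ s.t = T ∧ ∀ i, s.cnt i = (bundle n (theAlg hn α) v i T).card ∧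
      s.hc i = ((bundle n (theAlg hn α) v i T).filter fun t => v t i = α i).card ∧
      s.nh i = ((Finset.range T).filter fun t => v t i = α i).card := by
  induction T with
  | zero =>
    refine ⟨St.init_inv n hn, hn, rfl, fun i => ?_⟩
    simp [St.run, St.init, bundle]
  | succ T ih =>
    have ha := alloc_theAlg hn α v T
    have hr := St.run_succ hn α v T
    simp only at ih ⊢
    rw [hr]
    set s := St.run hn α ((List.range T).map v) with hs
    obtain ⟨hI, hR, ht, hc⟩ := ih
    have hg : s.Good (highSet α (v T)) (s.pick hn (highSet α (v T))) := by
      have hex := hI.exists_good hn hR (highSet α (v T))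
      unfold St.pick
      rw [dif_pos hex]; exact hex.choose_spec
    have hw := (hI.core hn hR _ _ hg).wrap hn
    obtain ⟨w1, w2, w3, w4⟩ := St.wrap_same (s.core (highSet α (v T)) (s.pick hn (highSet α (v T))))
    refine ⟨hw.1, hw.2, ?_, fun i => ?_⟩
    · unfold St.next; rw [w1]; simp [St.core, ht]
    · obtain ⟨c1, c2, c3⟩ := hc i
      unfold St.next
      rw [w2, w3, w4]
      rw [← ha]
      have hnm : T ∉ bundle n (theAlg hn α) v i T := by simp [bundle]
      have hb : bundle n (theAlg hn α) v i (T + 1) = if alloc n (theAlg hn α) v T = i then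
          insert T (bundle n (theAlg hn α) v i T) else bundle n (theAlg hn α) v i T := by
        simp [bundle, Finset.range_add_one, Finset.filter_insert]
      have hmem : ∀ k, k ∈ highSet α (v T) ↔ v T k = α k := by simp [highSet]
      refine ⟨?_, ?_, ?_⟩
      · rw [hb]; simp only [St.core, c1]
        by_cases h1 : alloc n (theAlg hn α) v T = i
        · rw [if_pos h1, if_pos h1.symm, Finset.card_insert_of_notMem hnm]
        · rw [if_neg h1, if_neg (fun h => h1 h.symm)]
      · rw [hb]; simp only [St.core, c2, hmem]
        by_cases h1 : alloc n (theAlg hn α) v T = i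
        · rw [if_pos h1, Finset.filter_insert, h1]
          by_cases h2 : v T i = α i
          · rw [if_pos ⟨rfl, h2⟩, if_pos h2, Finset.card_insert_of_notMem]
            simp [hnm]
          · rw [if_neg (fun h => h2 h.2), if_neg h2]
        · rw [if_neg h1, if_neg (fun h => h1 h.1.symm)]
      · simp only [St.core, c3, hmem]
        rw [Finset.range_add_one, Finset.filter_insert]
        by_cases h2 : v T i = α i
        · rw [if_pos h2, if_pos h2, Finset.card_insert_of_notMem]; simp
        · rw [if_neg h2, if_neg h2]

/-- There is a deterministic online allocation algorithm such that, on every personalized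
`2`-value stream with parameters `α, β`: (1) every agent gets exactly one of the first `n`
goods; (2) at every time step `T` agent `i` holds at least `⌊n_h(i,T)/(3n−2)⌋` of its
high-valued goods, and at least one as soon as `n_h(i,T) ≥ n`; (3) at every `T ≥ n`,
`|A_i^T| ≥ ⌊(T−n)/(2n−1)⌋ + 1`. -/
theorem statement3 (n : ℕ) (hn : 1 ≤ n) (α β : Fin n → NNReal) (hβα : ∀ i, β i ≤ α i) :
    ∃ F : List (Fin n → NNReal) → Fin n,
      ∀ v : ℕ → Fin n → NNReal, (∀ (t : ℕ) (i : Fin n), v t i = α i ∨ v t i = β i) →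
        (∀ i : Fin n, (bundle n F v i n).card = 1) ∧
        (∀ (T : ℕ) (i : Fin n),
            ((Finset.range T).filter fun t => v t i = α i).card / (3 * n - 2) ≤
              ((bundle n F v i T).filter fun t => v t i = α i).card ∧
            (n ≤ ((Finset.range T).filter fun t => v t i = α i).card →
              1 ≤ ((bundle n F v i T).filter fun t => v t i = α i).card)) ∧
        (∀ T : ℕ, n ≤ T → ∀ i : Fin n,
            (T - n) / (2 * n - 1) + 1 ≤ (bundle n F v i T).card) := by
  refine ⟨theAlg hn α, fun v _ => ⟨fun i => ?_, fun T i => ?_, fun T hT i => ?_⟩⟩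
  · obtain ⟨hI, hR, ht, hc⟩ := run_spec hn α v n
    rw [← (hc i).1]
    have h1 := hI.cnt1 ht.le i
    have h2 := hI.cntb i
    have h3 := hI.time
    have : (St.run hn α ((List.range n).map v)).b ≠ 0 := by
      intro hb; rw [hb, ht] at h3; omega
    omega
  · obtain ⟨hI, hR, ht, hc⟩ := run_spec hn α v T
    obtain ⟨-, c2, c3⟩ := hc i
    rw [← c2, ← c3]
    have h1 := hI.nhle i
    have h2 := hI.l1le i
    have h3 := hI.l2le i
    have h4 := hI.hc0 i
    constructor
    · rw [← Nat.lt_add_one_iff, Nat.div_lt_iff_lt_mul (by omega), Nat.add_mul, Nat.mul_comm]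
      omega
    · intro h5
      by_contra h6
      have h7 : (St.run hn α ((List.range T).map v)).hc i = 0 := by omega
      have h8 := h4 h7
      rw [h7, h8] at h1
      omega
  · obtain ⟨hI, hR, ht, hc⟩ := run_spec hn α v T
    rw [← (hc i).1]
    refine le_trans ?_ (hI.cntb i)
    have h3 := hI.time
    rw [Nat.succ_le_iff, Nat.div_lt_iff_lt_mul (by omega)]
    omega

end
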